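/- Let l be a positive integer. For every A ∈ yℌ, B ∈ ℌx and every integer s ≥ 0, one has Z(∂_l(A) (x+y)^s B) + Z(A (x+y)^s ∂_l(B)) = 0; equivalently f(∂_l(A), B) + f(A, ∂_l(B)) = 0. -/

import Mathlib

open scoped BigOperators

noncomputable section

/-- `ℌ = ℚ⟨x,y⟩`, the free noncommutative polynomial ring in two indeterminates,
realized as the free `ℚ`-algebra on `Bool` (`false ↦ x`, `true ↦ y`). -/
abbrev H : Type := FreeAlgebra ℚ Bool

/-- The indeterminate `x`. -/
def Hx : H := FreeAlgebra.ι ℚ false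

/-- The indeterminate `y`. -/
def Hy : H := FreeAlgebra.ι ℚ true

/-- The multiple zeta value `ζ(k₁,…,k_r) = ∑_{0<n₁<⋯<n_r} 1/(n₁^{k₁}⋯n_r^{k_r})`. -/
def MZV (r : ℕ) (k : Fin r → ℕ) : ℝ :=
  ∑' n : {n : Fin r → ℕ // (∀ i, 0 < n i) ∧ StrictMono n},
    ∏ i, (1 : ℝ) / (n.1 i : ℝ) ^ (k i)

/-- `Z : yℌx → ℝ` is the `ℚ`-linear map with `Z(y x^{k₁-1} ⋯ y x^{k_r-1}) = ζ(k₁,…,k_r)`.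
We encode it as a `ℚ`-linear map on all of `ℌ` whose values on the basis monomials
`y x^{k₁-1} ⋯ y x^{k_r-1}` (with `k_r ≥ 2`) of `yℌx` are the multiple zeta values;
these values determine `Z` uniquely on the subspace `yℌx`. -/
def IsZetaMap (Z : H →ₗ[ℚ] ℝ) : Prop :=
  ∀ (r : ℕ) (k : Fin (r + 1) → ℕ), (∀ i, 1 ≤ k i) → 2 ≤ k (Fin.last r) →
    Z ((List.ofFn fun i => Hy * Hx ^ (k i - 1)).prod) = MZV (r + 1) k

/-- The family `f(A,B) = (Z(A(x+y)^s B))_{s ≥ 0}`. -/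
def fam (Z : H →ₗ[ℚ] ℝ) (A B : H) : ℕ → ℝ := fun s => Z (A * (Hx + Hy) ^ s * B)

/-- The `ℚ`-bilinear product `◇` on `ℌ`, characterized by its recursive defining
properties (which determine it uniquely). -/
def IsDiamond (d : H →ₗ[ℚ] H →ₗ[ℚ] H) : Prop :=
  (∀ w, d w 1 = w) ∧ (∀ w, d 1 w = w) ∧
  (∀ w1 w2, d (Hx * w1) (Hx * w2) = Hx * d w1 (Hx * w2) - Hx * d (Hy * w1) w2) ∧
  (∀ w1 w2, d (Hx * w1) (Hy * w2) = Hx * d w1 (Hy * w2) + Hy * d (Hx * w1) w2) ∧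
  (∀ w1 w2, d (Hy * w1) (Hx * w2) = Hy * d w1 (Hx * w2) + Hx * d (Hy * w1) w2) ∧
  (∀ w1 w2, d (Hy * w1) (Hy * w2) = Hy * d w1 (Hy * w2) - Hy * d (Hx * w1) w2)

/-- The harmonic product `∗` on `ℌ`, characterized by its recursive defining
properties (which determine it uniquely). -/
def IsHarmonic (st : H →ₗ[ℚ] H →ₗ[ℚ] H) : Prop :=
  (∀ w, st w 1 = w) ∧ (∀ w, st 1 w = w) ∧
  (∀ w1 w2, st (Hx * w1) w2 = Hx * st w1 w2) ∧
  (∀ w1 w2, st w1 (Hx * w2) = Hx * st w1 w2) ∧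
  (∀ w1 w2, st (Hy * w1) (Hy * w2) = Hy * (st w1 (Hy * w2) + st (Hy * w1) w2 + Hx * st w1 w2))

/-- The anti-automorphism `τ` of `ℌ` interchanging `x` and `y`, characterized by
being `ℚ`-linear, anti-multiplicative, unital, and swapping the generators. -/
def IsTau (t : H →ₗ[ℚ] H) : Prop :=
  t 1 = 1 ∧ (∀ a b, t (a * b) = t b * t a) ∧ t Hx = Hy ∧ t Hy = Hx

/-- The automorphism `φ` of `ℌ` with `φ(x) = x + y` and `φ(y) = -y`. -/
def phi : H →ₐ[ℚ] H := FreeAlgebra.lift ℚ (fun b => if b then -Hy else Hx + Hy)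

/-- The automorphism `S₁` of `ℌ` with `S₁(x) = x` and `S₁(y) = x + y`. -/
def S1 : H →ₐ[ℚ] H := FreeAlgebra.lift ℚ (fun b => if b then Hx + Hy else Hx)

/-- The Dirichlet series `∑_{n ≥ 1} a_n / n^s` (with `a n` the coefficient indexed by
`n + 1`) converges to `L` at `s`, i.e. its partial sums tend to `L`. -/
def DSConv (a : ℕ → ℝ) (s : ℕ) (L : ℝ) : Prop :=
  Filter.Tendsto (fun N => ∑ n ∈ Finset.range N, a n / ((n : ℝ) + 1) ^ s)
    Filter.atTop (nhds L)


namespace OhnoAux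

open PowerSeries Finset.HasAntidiagonal

/-! ### Derivations on the free algebra -/

/-- twisted derivation with values in a `ℚ`-algebra along an algebra hom -/
def IsTw {R : Type} [Ring R] [Algebra ℚ R] (s : H →ₐ[ℚ] R) (E : H →ₗ[ℚ] R) : Prop :=
  ∀ a b, E (a * b) = E a * s b + s a * E b

lemma IsTw.ext' {R : Type} [Ring R] [Algebra ℚ R] {s : H →ₐ[ℚ] R} {E F : H →ₗ[ℚ] R}
    (hE : IsTw s E) (hF : IsTw s F) (hx : E Hx = F Hx) (hy : E Hy = F Hy) : E = F := by
  have one : ∀ {G : H →ₗ[ℚ] R}, IsTw s G → G 1 = 0 := by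
    intro G hG
    have := hG 1 1
    simp at this
    exact this
  ext v
  refine FreeAlgebra.induction ℚ Bool (motive := fun v => E v = F v) ?_ ?_ ?_ ?_ v
  · intro r
    rw [Algebra.algebraMap_eq_smul_one, map_smul, map_smul, one hE, one hF]
  · intro b
    cases b
    · exact hx
    · exact hy
  · intro a b ha hb
    rw [hE, hF, ha, hb]
  · intro a b ha hb
    rw [map_add, map_add, ha, hb]

/-- algebra hom into the trivial square zero extension -/
def derHom (f : Bool → H) : H →ₐ[ℚ] TrivSqZeroExt H H :=
  FreeAlgebra.lift ℚ (fun b => TrivSqZeroExt.inl (FreeAlgebra.ι ℚ b) + TrivSqZeroExt.inr (f b))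

lemma derHom_fst (f : Bool → H) (v : H) : (derHom f v).fst = v := by
  have : (TrivSqZeroExt.fstHom ℚ H H).comp (derHom f) = AlgHom.id ℚ H := by
    ext b
    simp [derHom]
  exact DFunLike.congr_fun this v

/-- the derivation with given values on the generators -/
def der (f : Bool → H) : H →ₗ[ℚ] H :=
  { toFun := fun v => (derHom f v).snd
    map_add' := by intro a b; simp
    map_smul' := by intro a b; simp }

lemma der_mul (f : Bool → H) (a b : H) : der f (a * b) = der f a * b + a * der f b := by
  simp only [der, LinearMap.coe_mk, AddHom.coe_mk, map_mul]
  simp [TrivSqZeroExt.snd_mul, derHom_fst]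
  abel

lemma der_x (f : Bool → H) : der f Hx = f false := by
  simp [der, derHom, Hx]

lemma der_y (f : Bool → H) : der f Hy = f true := by
  simp [der, derHom, Hy]

/-! ### Power series over `H` -/

abbrev P : Type := PowerSeries H

/-- diagonal summation `∑_j X^j g_j` -/
def dsum (g : ℕ → P) : P :=
  PowerSeries.mk fun m => ∑ p ∈ antidiagonal m, coeff p.1 (g p.2)

lemma coeff_dsum (g : ℕ → P) (m : ℕ) :
    coeff m (dsum g) = ∑ p ∈ antidiagonal m, coeff p.1 (g p.2) := by
  simp [dsum]

lemma dsum_mul (g : ℕ → P) (c : P) : dsum (fun j => g j * c) = dsum g * c := by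
  ext m
  rw [coeff_dsum, coeff_mul]
  simp only [coeff_mul, coeff_dsum, Finset.sum_mul]
  rw [Finset.sum_sigma', Finset.sum_sigma']
  refine Finset.sum_bij' (fun s _ => ⟨(s.2.1 + s.1.2, s.2.2), (s.2.1, s.1.2)⟩)
    (fun s _ => ⟨(s.2.1 + s.1.2, s.2.2), (s.2.1, s.1.2)⟩) ?_ ?_ ?_ ?_ ?_
  all_goals
    rintro ⟨⟨a, b⟩, ⟨c, d⟩⟩ h
    simp only [Finset.mem_sigma, mem_antidiagonal] at h ⊢
    try simp
    try omega

lemma mul_dsum (g : ℕ → P) (c : P) : dsum (fun j => c * g j) = c * dsum g := by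
  ext m
  rw [coeff_dsum, coeff_mul]
  simp only [coeff_mul, coeff_dsum, Finset.mul_sum]
  rw [Finset.sum_sigma', Finset.sum_sigma']
  refine Finset.sum_bij' (fun s _ => ⟨(s.2.1, s.2.2 + s.1.2), (s.2.2, s.1.2)⟩)
    (fun s _ => ⟨(s.1.1 + s.2.1, s.2.2), (s.1.1, s.2.1)⟩) ?_ ?_ ?_ ?_ ?_
  all_goals
    rintro ⟨⟨a, b⟩, ⟨c, d⟩⟩ h
    simp only [Finset.mem_sigma, mem_antidiagonal] at h ⊢
    try simp
    try omega

lemma dsum_add (g h : ℕ → P) : dsum (fun j => g j + h j) = dsum g + dsum h := by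
  ext m
  simp [coeff_dsum, Finset.sum_add_distrib]

lemma dsum_smul (r : ℚ) (g : ℕ → P) : dsum (fun j => r • g j) = r • dsum g := by
  ext m
  simp [coeff_dsum, Finset.smul_sum]

/-- coefficientwise application of a linear map -/
def cw (d : H →ₗ[ℚ] H) : P →ₗ[ℚ] P where
  toFun F := PowerSeries.mk fun m => d (coeff m F)
  map_add' F G := by ext m; simp
  map_smul' r F := by ext m; simp

lemma coeff_cw (d : H →ₗ[ℚ] H) (F : P) (m : ℕ) : coeff m (cw d F) = d (coeff m F) := by
  simp [cw]

lemma cw_mul (f : Bool → H) (F G : P) :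
    cw (der f) (F * G) = cw (der f) F * G + F * cw (der f) G := by
  ext m
  simp [coeff_cw, coeff_mul, map_sum, der_mul, Finset.sum_add_distrib]

/-- Euler operator -/
def theta : P →ₗ[ℚ] P where
  toFun F := PowerSeries.mk fun m => (m : ℚ) • coeff m F
  map_add' F G := by ext m; simp
  map_smul' r F := by
    ext m
    simp only [coeff_mk, RingHom.id_apply, PowerSeries.coeff_smul]
    exact smul_comm _ _ _

lemma coeff_theta (F : P) (m : ℕ) : coeff m (theta F) = (m : ℚ) • coeff m F := by
  simp [theta]

lemma theta_mul (F G : P) : theta (F * G) = theta F * G + F * theta G := by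
  ext m
  simp only [coeff_theta, coeff_mul, map_add, Finset.smul_sum, ← Finset.sum_add_distrib]
  refine Finset.sum_congr rfl fun p hp => ?_
  rw [mem_antidiagonal] at hp
  rw [← hp, smul_mul_assoc, mul_smul_comm, ← add_smul]
  push_cast
  rfl

/-- geometric series -/
def geo (a : H) : P := PowerSeries.mk fun j => a ^ j

/-- `x ↦ x, y ↦ y/(1-tx)` -/
def sg : H →ₐ[ℚ] P := FreeAlgebra.lift ℚ (fun b => if b then C Hy * geo Hx else C Hx)

/-- `x ↦ 1/(1-ty) x, y ↦ y` -/
def bsg : H →ₐ[ℚ] P := FreeAlgebra.lift ℚ (fun b => if b then C Hy else geo Hy * C Hx)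

lemma sg_x : sg Hx = C Hx := by simp [sg, Hx]
lemma sg_y : sg Hy = C Hy * geo Hx := by simp [sg, Hy]
lemma bsg_x : bsg Hx = geo Hy * C Hx := by simp [bsg, Hx]
lemma bsg_y : bsg Hy = C Hy := by simp [bsg, Hy]

/-- `S̄_j : x ↦ y^j x, y ↦ 0` for `j ≥ 1` -/
def Sb (j : ℕ) : H →ₗ[ℚ] H := der fun b => if b then 0 else if j = 0 then 0 else Hy ^ j * Hx

/-- `∂_j`, with `∂_0 = 0`. -/
def dl (j : ℕ) : H →ₗ[ℚ] H := der fun b => if j = 0 then 0 else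
  if b then -(Hy * (Hx + Hy) ^ (j - 1) * Hx) else Hy * (Hx + Hy) ^ (j - 1) * Hx

def sumS (s : H →ₐ[ℚ] P) : H →ₗ[ℚ] P where
  toFun w := dsum fun j => s (Sb j w)
  map_add' a b := by simp only [map_add, dsum_add]
  map_smul' r b := by simp only [map_smul, dsum_smul, RingHom.id_apply]

lemma sumS_tw (s : H →ₐ[ℚ] P) : IsTw s (sumS s) := by
  intro a b
  simp only [sumS, LinearMap.coe_mk, AddHom.coe_mk, ← dsum_mul, ← mul_dsum, ← dsum_add]
  congr 1
  ext1 j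
  rw [Sb, der_mul]
  simp

def sumD : H →ₗ[ℚ] P where
  toFun w := dsum fun j => cw (dl j) (sg w)
  map_add' a b := by simp only [map_add, dsum_add]
  map_smul' r b := by simp only [map_smul, dsum_smul, RingHom.id_apply]

lemma sumD_tw : IsTw sg sumD := by
  intro a b
  simp only [sumD, LinearMap.coe_mk, AddHom.coe_mk, ← dsum_mul, ← mul_dsum, ← dsum_add]
  congr 1
  ext1 j
  rw [dl, map_mul, cw_mul]

lemma theta_tw (s : H →ₐ[ℚ] P) : IsTw s (theta.comp s.toLinearMap) := by
  intro a b
  simp [theta_mul]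

lemma theta_C (a : H) : theta (C a) = 0 := by
  ext m
  rw [coeff_theta, coeff_C]
  split_ifs with h <;> simp [h]

lemma dsum_shift (g : ℕ → P) : dsum g = g 0 + X * dsum (fun j => g (j + 1)) := by
  ext m
  cases m with
  | zero => simp [coeff_dsum]
  | succ m =>
    rw [coeff_dsum, Finset.Nat.sum_antidiagonal_succ', map_add, coeff_succ_X_mul, coeff_dsum, add_comm]

lemma dsum_C_pow (a : H) : dsum (fun j => C (a ^ j)) = geo a := by
  ext m
  rw [coeff_dsum, Finset.sum_eq_single (0, m)]
  · simp [geo]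
  · rintro ⟨i, j⟩ h1 h2
    rw [mem_antidiagonal] at h1
    rw [coeff_C, if_neg]
    rintro rfl
    simp at h1
    exact h2 (by simp [h1])
  · intro h
    simp at h

/-- first key identity -/
lemma theta_bsg : theta.comp bsg.toLinearMap = sumS bsg := by
  apply IsTw.ext' (theta_tw _) (sumS_tw _)
  · ext m
    simp only [LinearMap.comp_apply, AlgHom.toLinearMap_apply, sumS, LinearMap.coe_mk, AddHom.coe_mk,
      Sb, der_x, coeff_theta, coeff_dsum]
    simp only [bsg_x, coeff_mul_C, geo, coeff_mk]
    cases m with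
    | zero => simp
    | succ m =>
      rw [Finset.Nat.sum_antidiagonal_succ']
      have : ∀ p ∈ antidiagonal m, coeff p.1 (bsg (if (false = true) then 0 else
          if p.2 + 1 = 0 then 0 else Hy ^ (p.2 + 1) * Hx)) = Hy ^ (m + 1) * Hx := by
        intro p hp
        rw [mem_antidiagonal] at hp
        simp only [Bool.false_eq_true, if_false, Nat.succ_ne_zero, map_mul, map_pow, bsg_x, bsg_y]
        rw [← map_pow, coeff_C_mul, coeff_mul_C]
        simp only [geo, coeff_mk]
        rw [← mul_assoc, ← pow_add, ← hp]
        congr 2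
        omega
      rw [Finset.sum_congr rfl this]
      simp [← Nat.cast_smul_eq_nsmul ℚ]
  · simp only [LinearMap.comp_apply, AlgHom.toLinearMap_apply, sumS, LinearMap.coe_mk, AddHom.coe_mk,
      Sb, der_y, bsg_y, theta_C]
    ext m
    simp [coeff_dsum]

lemma geo_mul (a : H) : (1 - X * C a) * geo a = 1 := by
  ext m
  rw [sub_mul, one_mul, mul_assoc]
  cases m with
  | zero => simp [geo]
  | succ m => simp [geo, coeff_succ_X_mul, pow_succ', coeff_one]

lemma mul_geo (a : H) : geo a * (1 - X * C a) = 1 := by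
  ext m
  rw [mul_sub, mul_one, ← mul_assoc, (commute_X (geo a)).eq, mul_assoc]
  cases m with
  | zero => simp [geo]
  | succ m => simp [geo, coeff_succ_X_mul, pow_succ, coeff_one]

/-- extension of `∑ t^j ∂_j` to power series -/
def Dh (F : P) : P := dsum fun j => cw (dl j) F

lemma Dh_mul (F G : P) : Dh (F * G) = Dh F * G + F * Dh G := by
  simp only [Dh, ← dsum_mul, ← mul_dsum, ← dsum_add]
  congr 1
  ext1 j
  rw [dl, cw_mul]

lemma Dh_add (F G : P) : Dh (F + G) = Dh F + Dh G := by
  simp only [Dh, ← dsum_add, map_add]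

lemma dl_one (j : ℕ) : dl j 1 = 0 := by
  have := der_mul (fun b => if j = 0 then 0 else
    if b then -(Hy * (Hx + Hy) ^ (j - 1) * Hx) else Hy * (Hx + Hy) ^ (j - 1) * Hx) 1 1
  simp at this
  exact this

lemma cw_C (d : H →ₗ[ℚ] H) (a : H) : cw d (C a) = C (d a) := by
  ext m
  rw [coeff_cw, coeff_C, coeff_C]
  split_ifs <;> simp

lemma Dh_X : Dh X = 0 := by
  have : ∀ j, cw (dl j) X = 0 := by
    intro j
    ext m
    rw [coeff_cw, coeff_X]
    split_ifs <;> simp [dl_one]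
  ext m
  simp [Dh, this, coeff_dsum]

lemma Dh_one : Dh 1 = 0 := by
  have := Dh_mul 1 1
  simp at this
  exact this

lemma Dh_C_x : Dh (C Hx) = X * (C Hy * geo (Hx + Hy) * C Hx) := by
  rw [Dh, dsum_shift, ← dsum_C_pow, ← mul_dsum _ (C Hy), ← dsum_mul]
  simp [cw_C, dl, der_x]

lemma Dh_C_y : Dh (C Hy) = - (X * (C Hy * geo (Hx + Hy) * C Hx)) := by
  rw [← Dh_C_x, eq_neg_iff_add_eq_zero, ← Dh_add]
  have : ∀ j, cw (dl j) (C Hy + C Hx) = 0 := by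
    intro j
    rw [← map_add, cw_C, map_add, dl, der_x, der_y]
    by_cases h : j = 0 <;> simp [h]
  ext m
  simp only [Dh, this, coeff_dsum]
  simp

lemma key_G {a V G W x y T : P} (ha : a = y * V)
    (hV : V * (1 - T * x) = 1) (hG : G * (1 - T * a) = 1)
    (hW : (1 - T * (x + y)) * W = 1) : a * G = y * W := by
  have h1 : (1 - T * a) * (1 - T * x) = 1 - T * (x + y) := by
    have : (1 - T * a) * (1 - T * x) = (1 - T * x) - T * (y * (V * (1 - T * x))) := by
      rw [ha]; noncomm_ring
    rw [this, hV]; noncomm_ring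
  have h2 : G = (1 - T * x) * W := by
    calc G = G * ((1 - T * (x + y)) * W) := by rw [hW, mul_one]
      _ = (G * (1 - T * a)) * ((1 - T * x) * W) := by rw [← h1]; noncomm_ring
      _ = _ := by rw [hG, one_mul]
  rw [h2, ha]
  calc y * V * ((1 - T * x) * W) = y * (V * (1 - T * x)) * W := by noncomm_ring
    _ = _ := by rw [hV, mul_one]

/-- `1/(1-ta)`, `a = sg y` -/
def GG : P := dsum fun j => (sg Hy) ^ j

lemma GG_mul : GG * (1 - X * sg Hy) = 1 := by
  have : GG = 1 + X * (GG * sg Hy) := by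
    conv_lhs => rw [GG, dsum_shift]
    simp [GG, ← dsum_mul, pow_succ]
  rw [mul_sub, mul_one, ← mul_assoc, (commute_X GG).eq, mul_assoc, sub_eq_iff_eq_add]
  exact this

lemma mul_GG : (1 - X * sg Hy) * GG = 1 := by
  have : GG = 1 + X * (sg Hy * GG) := by
    conv_lhs => rw [GG, dsum_shift]
    simp [GG, ← mul_dsum, pow_succ']
  rw [sub_mul, one_mul, mul_assoc, sub_eq_iff_eq_add]
  exact this

lemma a_GG : sg Hy * GG = C Hy * geo (Hx + Hy) := by
  refine key_G (T := X) (V := geo Hx) (x := C Hx) sg_y (mul_geo _) GG_mul ?_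
  rw [← map_add]
  exact geo_mul _

lemma Dh_geo : Dh (geo Hx) = geo Hx * (X * Dh (C Hx)) * geo Hx := by
  have h := Dh_mul (geo Hx) (1 - X * C Hx)
  have h2 : Dh (1 - X * C Hx) = - (X * Dh (C Hx)) := by
    have h3 := Dh_add (1 - X * C Hx) (X * C Hx)
    rw [sub_add_cancel, Dh_one, Dh_mul X, Dh_X, zero_mul, zero_add] at h3
    rw [eq_comm, add_eq_zero_iff_eq_neg] at h3
    exact h3
  rw [mul_geo, Dh_one, h2] at h
  have h4 : Dh (geo Hx) * (1 - X * C Hx) = geo Hx * (X * Dh (C Hx)) := by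
    rw [mul_neg, eq_comm, ← sub_eq_add_neg, sub_eq_zero] at h
    exact h
  rw [← h4, mul_assoc, geo_mul, mul_one]

lemma theta_X : theta X = X := by
  ext m
  rw [coeff_theta, coeff_X]
  split_ifs with h <;> simp [h]

lemma theta_one : theta (1 : P) = 0 := by
  have := theta_mul 1 1
  simp at this
  exact this

lemma theta_geo : theta (geo Hx) = geo Hx * (X * C Hx) * geo Hx := by
  have h := theta_mul (geo Hx) (1 - X * C Hx)
  rw [mul_geo, theta_one, map_sub, theta_one, theta_mul X, theta_C, theta_X, mul_zero, add_zero,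
    zero_sub, mul_neg, eq_comm, ← sub_eq_add_neg, sub_eq_zero] at h
  rw [← h, mul_assoc, geo_mul, mul_one]

/-- second key identity -/
lemma key_sg : sumS sg - theta.comp sg.toLinearMap = sumD := by
  refine IsTw.ext' ?_ sumD_tw ?_ ?_
  · intro a b
    simp only [LinearMap.sub_apply, sumS_tw sg a b, theta_tw sg a b]
    noncomm_ring
  · change sumS sg Hx - theta (sg Hx) = Dh (sg Hx)
    rw [sg_x, theta_C, sub_zero, Dh_C_x, ← a_GG]
    simp only [sumS, LinearMap.coe_mk, AddHom.coe_mk]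
    rw [dsum_shift, GG, ← mul_dsum _ (sg Hy), ← dsum_mul]
    simp [Sb, der_x, sg_x, pow_succ']
  · change sumS sg Hy - theta (sg Hy) = Dh (sg Hy)
    have : sumS sg Hy = 0 := by
      ext m
      simp [sumS, Sb, der_y, coeff_dsum]
    rw [this, zero_sub]
    have e1 : theta (sg Hy) = X * (sg Hy * C Hx * geo Hx) := by
      rw [sg_y, theta_mul, theta_C, theta_geo, zero_mul, zero_add]
      simp only [← mul_assoc]
      rw [(commute_X (C Hy * geo Hx)).eq]
      simp only [← mul_assoc]
    have e2 : Dh (sg Hy) = - (X * (((1 - X * sg Hy) * (sg Hy * GG)) * C Hx * geo Hx)) := by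
      rw [a_GG]
      conv_lhs => rw [sg_y]
      rw [Dh_mul, Dh_geo, Dh_C_y, Dh_C_x]
      have : C Hy * (geo Hx * (X * (X * (C Hy * geo (Hx + Hy) * C Hx))) * geo Hx)
          = X * (X * (sg Hy * (C Hy * geo (Hx + Hy) * C Hx)) * geo Hx) := by
        have : C Hy * (geo Hx * (X * (X * (C Hy * geo (Hx + Hy) * C Hx))) * geo Hx)
          = sg Hy * X * X * (C Hy * geo (Hx + Hy) * C Hx) * geo Hx := by
          rw [sg_y]; noncomm_ring
        rw [this, (commute_X _).eq, mul_assoc X, (commute_X _).eq]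
        noncomm_ring
      rw [this]
      noncomm_ring
    have e3 : (1 - X * sg Hy) * (sg Hy * GG) = sg Hy := by
      have : (1 - X * sg Hy) * (sg Hy * GG) = sg Hy * ((1 - X * sg Hy) * GG) := by
        have : sg Hy * (1 - X * sg Hy) = (1 - X * sg Hy) * sg Hy := by
          rw [mul_sub, sub_mul, mul_one, one_mul, ← mul_assoc, (commute_X _).eq]
        rw [← mul_assoc, ← this, mul_assoc]
      rw [this, mul_GG, mul_one]
    rw [e1, e2, e3]

/-! ### From Ohno to the derivation relation -/

def Adm (v : H) : Prop := ∃ u, v = Hy * u * Hx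

lemma adm_Sb (j : ℕ) {v : H} (h : Adm v) : Adm (Sb j v) := by
  obtain ⟨u, rfl⟩ := h
  by_cases hj : j = 0
  · refine ⟨Sb j u, ?_⟩
    simp only [Sb, der_mul, der_x, der_y, hj]
    simp
  · refine ⟨Sb j u + u * Hy ^ j, ?_⟩
    simp only [Sb, der_mul, der_x, der_y, hj]
    simp
    noncomm_ring

lemma adm_sg (i : ℕ) {v : H} (h : Adm v) : Adm (coeff i (sg v)) := by
  obtain ⟨u, rfl⟩ := h
  refine ⟨coeff i (geo Hx * sg u), ?_⟩
  rw [map_mul sg, map_mul sg, sg_x, sg_y, coeff_mul_C, mul_assoc, coeff_C_mul]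

lemma coeff_zero_sg (v : H) : coeff 0 (sg v) = v := by
  refine FreeAlgebra.induction ℚ Bool (motive := fun v => coeff 0 (sg v) = v) ?_ ?_ ?_ ?_ v
  · intro r
    rw [Algebra.algebraMap_eq_smul_one, map_smul, map_one]
    simp
  · intro b
    cases b
    · change coeff 0 (sg Hx) = Hx
      rw [sg_x]; simp
    · change coeff 0 (sg Hy) = Hy
      rw [sg_y]; simp [geo]
  · intro a b ha hb
    rw [map_mul, coeff_mul]
    simp [-coeff_zero_eq_constantCoeff, ha, hb]
  · intro a b ha hb
    rw [map_add, map_add, ha, hb]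

theorem dl_zero_of_ohno (Z : H →ₗ[ℚ] ℝ)
    (hO : ∀ m v, Adm v → Z (coeff m (sg v)) = Z (coeff m (bsg v))) :
    ∀ m v, Adm v → Z (dl m v) = 0 := by
  intro m
  induction m using Nat.strong_induction_on with
  | _ m ih =>
    intro v hv
    have h1 := congrArg (fun F => Z (coeff m F)) (DFunLike.congr_fun key_sg v)
    have h2 := congrArg (fun F => Z (coeff m F)) (DFunLike.congr_fun theta_bsg v)
    simp only [LinearMap.sub_apply, LinearMap.comp_apply, AlgHom.toLinearMap_apply, map_sub,
      sumS, sumD, LinearMap.coe_mk, AddHom.coe_mk, coeff_theta, map_smul, coeff_dsum, map_sum,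
      coeff_cw] at h1 h2
    rw [← hO m v hv] at h2
    rw [h2, ← Finset.sum_sub_distrib, Finset.sum_eq_zero] at h1
    · rw [Finset.sum_eq_single (0, m)] at h1
      · rw [coeff_zero_sg] at h1
        exact h1.symm
      · rintro ⟨i, j⟩ hp hne
        rw [mem_antidiagonal] at hp
        simp only at hp
        refine ih j ?_ _ (adm_sg i hv)
        rcases Nat.eq_zero_or_pos i with rfl | hi
        · exact absurd (by simpa using hp) (fun h : j = m => hne (by rw [h]))
        · omega
      · intro h
        simp at h
    · intro p _
      rw [hO _ _ (adm_Sb _ hv), sub_self]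

/-- the main theorem, given Ohno -/
theorem main_of_ohno (Z : H →ₗ[ℚ] ℝ)
    (hO : ∀ m v, Adm v → Z (coeff m (sg v)) = Z (coeff m (bsg v)))
    (l : ℕ) (hl : 1 ≤ l) (D : H →ₗ[ℚ] H)
    (hD : ∀ a b : H, D (a * b) = D a * b + a * D b)
    (hDx : D Hx = Hy * (Hx + Hy) ^ (l - 1) * Hx)
    (hDy : D Hy = -(Hy * (Hx + Hy) ^ (l - 1) * Hx))
    (A B : H) (hA : ∃ w, A = Hy * w) (hB : ∃ w, B = w * Hx) (s : ℕ) :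
    Z (D A * (Hx + Hy) ^ s * B) + Z (A * (Hx + Hy) ^ s * D B) = 0 := by
  have hl0 : l ≠ 0 := by omega
  have e : D = dl l := by
    refine IsTw.ext' (s := AlgHom.id ℚ H) ?_ ?_ ?_ ?_
    · intro a b; simp [hD]
    · intro a b; simp [dl, der_mul]
    · simp [hDx, dl, der_x, hl0]
    · simp [hDy, dl, der_y, hl0]
  have hz : D (Hx + Hy) = 0 := by rw [map_add, hDx, hDy, add_neg_cancel]
  have hzs : ∀ s : ℕ, D ((Hx + Hy) ^ s) = 0 := by
    intro s
    induction s with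
    | zero =>
      have := hD 1 1
      simp at this
      simpa using this
    | succ s ih => rw [pow_succ, hD, ih, hz]; simp
  have h := dl_zero_of_ohno Z hO l (A * (Hx + Hy) ^ s * B) (by
    obtain ⟨a, rfl⟩ := hA
    obtain ⟨b, rfl⟩ := hB
    exact ⟨a * (Hx + Hy) ^ s * b, by noncomm_ring⟩)
  rw [← e, hD, hD, hzs, mul_zero, add_zero, map_add] at h
  exact h

end OhnoAux

namespace OhnoAux

open scoped ENNReal

/-! ### Connected sums -/

/-- the weights `1/(n-t)` -/
def wt (t : ℝ) (n : ℕ) : ℝ≥0∞ := if n = 0 then 0 else ENNReal.ofReal (1 / ((n : ℝ) - t))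

/-- nested sums attached to a word (in reverse order), with fixed largest index -/
def AA (t : ℝ) : List Bool → ℕ → ℝ≥0∞
  | [], n => if n = 0 then 1 else 0
  | false :: w, n => wt 0 n * AA t w n
  | true :: w, n => wt t n * ∑ a ∈ Finset.range n, AA t w a

def FF (t : ℝ) (w : List Bool) : ℝ≥0∞ := ∑' n, AA t w n

def Pt (t : ℝ) (n : ℕ) : ℝ := ∏ i ∈ Finset.range n, ((i : ℝ) + 1 - t)

lemma Pt_succ (t : ℝ) (n : ℕ) : Pt t (n + 1) = Pt t n * ((n : ℝ) + 1 - t) := by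
  simp [Pt, Finset.prod_range_succ]

lemma Pt_pos {t : ℝ} (ht : t < 1) (n : ℕ) : 0 < Pt t n := by
  refine Finset.prod_pos fun i _ => ?_
  have : (0 : ℝ) ≤ i := Nat.cast_nonneg i
  linarith

/-- the connector -/
def cc (t : ℝ) (a b : ℕ) : ℝ := Pt t a * Pt t b / Pt t (a + b)

lemma cc_symm (t : ℝ) (a b : ℕ) : cc t a b = cc t b a := by
  rw [cc, cc, mul_comm, add_comm]

lemma cc_pos {t : ℝ} (ht : t < 1) (a b : ℕ) : 0 < cc t a b :=
  div_pos (mul_pos (Pt_pos ht a) (Pt_pos ht b)) (Pt_pos ht _)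

lemma cc_zero {t : ℝ} (ht : t < 1) (a : ℕ) : cc t a 0 = 1 := by
  have := (Pt_pos ht a).ne'
  simp only [cc, add_zero]
  rw [show Pt t 0 = 1 by simp [Pt], mul_one, div_self this]

lemma cc_diff {t : ℝ} (ht : t < 1) (a n : ℕ) :
    cc t a n - cc t (a + 1) n = n * (1 / (((a + 1 : ℕ) : ℝ) - t) * cc t (a + 1) n) := by
  have h1 := (Pt_pos ht a).ne'
  have h2 := (Pt_pos ht n).ne'
  have h3 := (Pt_pos ht (a + n)).ne'
  have ha : (0 : ℝ) ≤ a := Nat.cast_nonneg a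
  have hn : (0 : ℝ) ≤ n := Nat.cast_nonneg n
  have h4 : (a : ℝ) + 1 - t ≠ 0 := by linarith
  have h5 : (a : ℝ) + n + 1 - t ≠ 0 := by linarith
  rw [cc, cc, show a + 1 + n = (a + n) + 1 by ring, Pt_succ, Pt_succ]
  push_cast
  field_simp
  ring

lemma cc_le {t : ℝ} (ht0 : 0 ≤ t) (ht : t < 1) (m n : ℕ) : cc t m (n + 1) ≤ 1 / ((m : ℝ) + 1 - t) := by
  have hm : (0 : ℝ) ≤ m := Nat.cast_nonneg m
  induction n with
  | zero =>
    have h1 := (Pt_pos ht m).ne'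
    have h4 : 0 < (m : ℝ) + 1 - t := by linarith
    rw [cc, Pt_succ, Pt_succ]
    simp only [Pt, Finset.range_zero, Finset.prod_empty]
    change Pt t m * _ / (Pt t m * _) ≤ _
    rw [mul_div_mul_left _ _ h1]
    gcongr
    simp [ht0]
  | succ n ih =>
    refine le_trans ?_ ih
    have hn : (0 : ℝ) ≤ n := Nat.cast_nonneg n
    have h2 := Pt_pos ht m
    have h3 := Pt_pos ht (n+1)
    have h4 := Pt_pos ht (m + (n + 1))
    rw [cc, cc, Pt_succ t (n+1), ← add_assoc m (n+1) 1, Pt_succ t (m + (n+1))]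
    rw [div_le_div_iff₀ (mul_pos h4 (by push_cast; linarith)) h4]
    push_cast
    have : Pt t m * Pt t (n+1) * Pt t (m + (n+1)) * ((n : ℝ) + 1 + 1 - t) ≤
      Pt t m * Pt t (n+1) * Pt t (m + (n+1)) * ((m : ℝ) + (n + 1) + 1 - t) := by
      refine mul_le_mul_of_nonneg_left (by linarith) (by positivity)
    nlinarith [this]

lemma cc_tendsto {t : ℝ} (ht0 : 0 ≤ t) (ht : t < 1) (n : ℕ) :
    Filter.Tendsto (fun m => cc t m (n + 1)) Filter.atTop (nhds 0) := by
  refine squeeze_zero (fun m => (cc_pos ht m _).le) (fun m => cc_le ht0 ht m n) ?_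
  simp only [one_div]
  apply Filter.Tendsto.inv_tendsto_atTop
  have : (fun m : ℕ => (m : ℝ) + 1 - t) = fun m : ℕ => (m : ℝ) + (1 - t) := by
    ext; ring
  rw [this]
  exact Filter.tendsto_atTop_add_const_right _ _ tendsto_natCast_atTop_atTop

lemma transport_hasSum {t : ℝ} (ht0 : 0 ≤ t) (ht : t < 1) (a n : ℕ) (hn : n ≠ 0) :
    HasSum (fun m : ℕ => 1 / (((a + m + 1 : ℕ) : ℝ) - t) * cc t (a + m + 1) n) (1 / (n : ℝ) * cc t a n) := by
  have hn' : (n : ℝ) ≠ 0 := by exact_mod_cast hn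
  have hpos : ∀ m : ℕ, 0 ≤ 1 / (((a + m + 1 : ℕ) : ℝ) - t) * cc t (a + m + 1) n := by
    intro m
    have hm : (0 : ℝ) ≤ (a + m : ℕ) := Nat.cast_nonneg _
    refine mul_nonneg (one_div_nonneg.2 ?_) (cc_pos ht _ _).le
    push_cast at hm ⊢
    linarith
  rw [hasSum_iff_tendsto_nat_of_nonneg hpos]
  have : ∀ N, ∑ m ∈ Finset.range N, 1 / (((a + m + 1 : ℕ) : ℝ) - t) * cc t (a + m + 1) n
      = 1 / (n : ℝ) * (cc t a n - cc t (a + N) n) := by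
    intro N
    induction N with
    | zero => simp
    | succ N ih =>
      rw [Finset.sum_range_succ, ih]
      have h := cc_diff ht (a + N) n
      rw [← add_assoc a N 1, show cc t a n - cc t (a + N + 1) n
        = (cc t a n - cc t (a + N) n) + (cc t (a + N) n - cc t (a + N + 1) n) by ring, h]
      field_simp
  simp only [this]
  obtain ⟨k, rfl⟩ := Nat.exists_eq_succ_of_ne_zero hn
  have h2 := (cc_tendsto ht0 ht k).comp (Filter.tendsto_add_atTop_nat a)
  have h3 : Filter.Tendsto (fun N => 1 / ((k.succ : ℕ) : ℝ) * (cc t a k.succ - cc t (a + N) k.succ)) Filter.atTop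
    (nhds (1 / ((k.succ : ℕ) : ℝ) * (cc t a k.succ - 0))) := by
    refine Filter.Tendsto.const_mul _ (Filter.Tendsto.const_sub _ ?_)
    refine h2.congr fun N => ?_
    simp [add_comm]
  simpa using h3

lemma transport {t : ℝ} (ht0 : 0 ≤ t) (ht : t < 1) (a n : ℕ) (hn : n ≠ 0) :
    ∑' m, (if a < m then wt t m * ENNReal.ofReal (cc t m n) else 0)
      = wt 0 n * ENNReal.ofReal (cc t a n) := by
  have h := transport_hasSum ht0 ht a n hn
  have hpos : ∀ m : ℕ, 0 ≤ 1 / (((a + m + 1 : ℕ) : ℝ) - t) := by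
    intro m
    have hm : (0 : ℝ) ≤ (a + m : ℕ) := Nat.cast_nonneg _
    refine one_div_nonneg.2 ?_
    push_cast at hm ⊢
    linarith
  rw [wt, if_neg hn, sub_zero, ← ENNReal.ofReal_mul (by positivity), ← h.tsum_eq,
    ENNReal.ofReal_tsum_of_nonneg (fun m => mul_nonneg (hpos m) (cc_pos ht _ _).le) h.summable]
  rw [← ENNReal.summable.sum_add_tsum_nat_add' (k := a + 1), Finset.sum_eq_zero, zero_add]
  · refine tsum_congr fun m => ?_
    rw [if_pos (by omega), wt, if_neg (by omega), ENNReal.ofReal_mul (hpos m)]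
    rw [show m + (a + 1) = a + m + 1 by omega]
  · intro i hi
    rw [Finset.mem_range] at hi
    rw [if_neg (by omega)]

/-- connected sum -/
def KK (t : ℝ) (u v : List Bool) : ℝ≥0∞ :=
  ∑' a, ∑' b, AA t u a * AA t v b * ENNReal.ofReal (cc t a b)

lemma KK_symm (t : ℝ) (u v : List Bool) : KK t u v = KK t v u := by
  rw [KK, ENNReal.tsum_comm, KK]
  refine tsum_congr fun a => tsum_congr fun b => ?_
  rw [cc_symm, mul_comm (AA t u b)]

lemma sum_range_ite (f : ℕ → ℝ≥0∞) (n : ℕ) :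
    ∑ a ∈ Finset.range n, f a = ∑' a, if a < n then f a else 0 := by
  rw [tsum_eq_sum (s := Finset.range n)]
  · refine Finset.sum_congr rfl fun a ha => ?_
    rw [if_pos (Finset.mem_range.1 ha)]
  · intro a ha
    rw [if_neg (by simpa using ha)]

lemma KK_y {t : ℝ} (ht0 : 0 ≤ t) (ht : t < 1) (u v : List Bool) (hv : AA t v 0 = 0) :
    KK t (true :: u) v = KK t u (false :: v) := by
  calc KK t (true :: u) v
      = ∑' m, ∑' b, ∑' a, AA t u a * AA t v b * (if a < m then wt t m * ENNReal.ofReal (cc t m b) else 0) := by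
        refine tsum_congr fun m => tsum_congr fun b => ?_
        rw [AA, sum_range_ite, mul_assoc, mul_assoc, mul_comm (tsum _), ← mul_assoc, ← ENNReal.tsum_mul_left]
        refine tsum_congr fun a => ?_
        split_ifs
        · ring
        · simp
    _ = ∑' a, ∑' b, ∑' m, AA t u a * AA t v b * (if a < m then wt t m * ENNReal.ofReal (cc t m b) else 0) := by
        rw [ENNReal.tsum_comm]
        rw [ENNReal.tsum_comm (f := fun a b => ∑' m, AA t u a * AA t v b * (if a < m then wt t m * ENNReal.ofReal (cc t m b) else 0))]
        refine tsum_congr fun b => ?_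
        rw [ENNReal.tsum_comm]
    _ = _ := by
        refine tsum_congr fun a => tsum_congr fun b => ?_
        rw [ENNReal.tsum_mul_left]
        by_cases hb : b = 0
        · subst hb
          simp [hv, AA]
        · rw [transport ht0 ht a b hb, AA]
          ring

lemma KK_x {t : ℝ} (ht0 : 0 ≤ t) (ht : t < 1) (u v : List Bool) (hu : AA t u 0 = 0) :
    KK t (false :: u) v = KK t u (true :: v) := by
  rw [KK_symm, ← KK_y ht0 ht _ _ hu, KK_symm]

lemma AA_zero (t : ℝ) (u : List Bool) : AA t (u ++ [true]) 0 = 0 := by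
  cases u with
  | nil => simp [AA]
  | cons b u => cases b <;> simp [AA, wt]

lemma KK_nil {t : ℝ} (ht : t < 1) (u : List Bool) : KK t u [] = FF t u := by
  rw [KK, FF]
  refine tsum_congr fun a => ?_
  rw [tsum_eq_single 0]
  · simp [AA, cc_zero ht]
  · intro b hb
    simp [AA, hb]

lemma KK_chain {t : ℝ} (ht0 : 0 ≤ t) (ht : t < 1) (u v : List Bool) :
    KK t (u ++ [true]) (v ++ [true]) = FF t (false :: ((u.map not).reverse ++ (v ++ [true]))) := by
  induction u generalizing v with
  | nil =>
    rw [List.nil_append, KK_y ht0 ht _ _ (AA_zero t v), KK_symm, KK_nil ht]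
    rfl
  | cons b u ih =>
    cases b
    · rw [List.cons_append, KK_x ht0 ht _ _ (AA_zero t u), ← List.cons_append, ih]
      simp
    · rw [List.cons_append, KK_y ht0 ht _ _ (AA_zero t v), ← List.cons_append, ih]
      simp

/-- Ohno's relation in generating function form -/
lemma FF_dual {t : ℝ} (ht0 : 0 ≤ t) (ht : t < 1) (u : List Bool) :
    FF t (false :: (u ++ [true])) = FF t (false :: ((u.map not).reverse ++ [true])) := by
  rw [← KK_nil ht, KK_x ht0 ht _ _ (AA_zero t u)]
  exact KK_chain ht0 ht u []

end OhnoAux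

namespace OhnoAux

open scoped ENNReal
open Finset.HasAntidiagonal

/-! ### Convergence -/

lemma sum_inv_sqrt (n : ℕ) : ∑ a ∈ Finset.range (n + 1), 1 / √(a : ℝ) ≤ 2 * √(n : ℝ) := by
  induction n with
  | zero => simp
  | succ n ih =>
    rw [Finset.sum_range_succ]
    have h0 : (0 : ℝ) ≤ n := Nat.cast_nonneg n
    have h1 : 0 < √((n + 1 : ℕ) : ℝ) := Real.sqrt_pos.2 (by positivity)
    have h2 : 0 ≤ √(n : ℝ) := Real.sqrt_nonneg _
    have h3 : √((n + 1 : ℕ) : ℝ) ^ 2 = n + 1 := by rw [Real.sq_sqrt (by positivity)]; push_cast; rfl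
    have h4 : √(n : ℝ) ^ 2 = n := Real.sq_sqrt h0
    have : 1 / √((n + 1 : ℕ) : ℝ) ≤ 2 * (√((n + 1 : ℕ) : ℝ) - √(n : ℝ)) := by
      rw [div_le_iff₀ h1]
      nlinarith [sq_nonneg (√((n + 1 : ℕ) : ℝ) - √(n : ℝ))]
    linarith

lemma wt_le {t : ℝ} (ht : t ≤ 1 / 2) (n : ℕ) : wt t n ≤ ENNReal.ofReal (2 / n) := by
  rw [wt]
  split_ifs with h
  · simp
  · apply ENNReal.ofReal_le_ofReal
    have : (1 : ℝ) ≤ n := by exact_mod_cast Nat.one_le_iff_ne_zero.2 h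
    rw [div_le_div_iff₀ (by linarith) (by linarith)]
    linarith

lemma AA_le {t : ℝ} (ht : t ≤ 1 / 2) (w : List Bool) :
    ∃ K : ℝ, 0 ≤ K ∧ ∀ n, AA t w n ≤ (if n = 0 then 1 else 0) + ENNReal.ofReal (K * (1 / √(n : ℝ))) := by
  induction w with
  | nil => exact ⟨0, le_rfl, fun n => by simp [AA]⟩
  | cons b w ih =>
    obtain ⟨K, hK, h⟩ := ih
    cases b
    · refine ⟨2 * K, by positivity, fun n => ?_⟩
      rw [AA]
      rcases Nat.eq_zero_or_pos n with rfl | hn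
      · simp [wt]
      · have h1 := h n
        rw [if_neg hn.ne', zero_add] at h1 ⊢
        refine (mul_le_mul' (wt_le (by norm_num) n) h1).trans ?_
        rw [← ENNReal.ofReal_mul (by positivity)]
        apply ENNReal.ofReal_le_ofReal
        have hn1 : (1 : ℝ) ≤ n := by exact_mod_cast hn
        rw [mul_assoc]
        have : 2 / (n : ℝ) ≤ 2 := div_le_self (by norm_num) hn1
        exact mul_le_mul_of_nonneg_right this (by positivity)
    · refine ⟨2 + 4 * K, by positivity, fun n => ?_⟩
      rw [AA]
      rcases Nat.eq_zero_or_pos n with rfl | hn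
      · simp [wt]
      · rw [if_neg hn.ne', zero_add]
        have h2 : ∑ a ∈ Finset.range n, AA t w a ≤ ENNReal.ofReal (1 + K * (2 * √(n : ℝ))) := by
          obtain ⟨k, rfl⟩ := Nat.exists_eq_succ_of_ne_zero hn.ne'
          refine (Finset.sum_le_sum fun a _ => h a).trans ?_
          rw [Finset.sum_add_distrib, ← ENNReal.ofReal_sum_of_nonneg (fun i _ => by positivity),
            ← Finset.mul_sum, ENNReal.ofReal_add (by norm_num) (by positivity)]
          refine add_le_add ?_ (ENNReal.ofReal_le_ofReal ?_)
          · rw [Finset.sum_ite_eq' (Finset.range (k+1)) 0]; simp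
          · refine mul_le_mul_of_nonneg_left ((sum_inv_sqrt k).trans ?_) hK
            gcongr
            simp
        refine (mul_le_mul' (wt_le ht n) h2).trans ?_
        rw [← ENNReal.ofReal_mul (by positivity)]
        apply ENNReal.ofReal_le_ofReal
        have hn1 : (1 : ℝ) ≤ √(n : ℝ) := by
          rw [Real.one_le_sqrt]; exact_mod_cast hn
        have h3 : √(n : ℝ) ^ 2 = n := Real.sq_sqrt (by positivity)
        have : 2 / (n : ℝ) = 2 / √(n : ℝ) * (1 / √(n : ℝ)) := by
          rw [← h3, sq]
          field_simp
          simp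
        rw [this, mul_right_comm]
        refine mul_le_mul_of_nonneg_right ?_ (by positivity)
        rw [div_mul_eq_mul_div, div_le_iff₀ (by linarith)]
        nlinarith

lemma FF_lt_top {t : ℝ} (ht : t ≤ 1 / 2) (w : List Bool) : FF t (false :: w) ≠ ∞ := by
  obtain ⟨K, hK, h⟩ := AA_le ht w
  have hs : Summable fun n : ℕ => K * (1 / (n : ℝ) ^ (3 / 2 : ℝ)) :=
    (Real.summable_one_div_nat_rpow.2 (by norm_num)).mul_left K
  have hle : FF t (false :: w) ≤ ∑' n : ℕ, ENNReal.ofReal (K * (1 / (n : ℝ) ^ (3 / 2 : ℝ))) := by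
    refine ENNReal.tsum_le_tsum fun n => ?_
    rw [AA]
    rcases Nat.eq_zero_or_pos n with rfl | hn
    · simp [wt]
    · have h1 := h n
      rw [if_neg hn.ne', zero_add] at h1
      refine (mul_le_mul' le_rfl h1).trans ?_
      rw [wt, if_neg hn.ne', ← ENNReal.ofReal_mul (by rw [sub_zero]; positivity)]
      apply ENNReal.ofReal_le_ofReal
      have hn1 : (0 : ℝ) < n := by exact_mod_cast hn
      rw [show (3 / 2 : ℝ) = 1 + 1 / 2 by norm_num, Real.rpow_add hn1, Real.rpow_one,
        ← Real.sqrt_eq_rpow, sub_zero]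
      apply le_of_eq
      field_simp
  refine ne_top_of_le_ne_top ?_ hle
  rw [← ENNReal.ofReal_tsum_of_nonneg (fun n => by positivity) hs]
  exact ENNReal.ofReal_ne_top

/-! ### Words and expansion in `t` -/

/-- the word (in reverse order) as an element of `H` -/
def EE : List Bool → H
  | [] => 1
  | b :: w => EE w * FreeAlgebra.ι ℚ b

/-- sum over the words occurring in the `m`-th coefficient of `sg` -/
def sigSum {M : Type} [AddCommMonoid M] : ℕ → List Bool → (List Bool → M) → M
  | m, [], g => if m = 0 then g [] else 0
  | m, false :: w, g => sigSum m w fun w' => g (false :: w')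
  | m, true :: w, g => ∑ p ∈ antidiagonal m, sigSum p.1 w fun w' => g (List.replicate p.2 false ++ true :: w')

lemma map_sigSum {M N : Type} [AddCommMonoid M] [AddCommMonoid N] (φ : M →+ N) (m : ℕ) (w : List Bool)
    (g : List Bool → M) : φ (sigSum m w g) = sigSum m w fun w' => φ (g w') := by
  induction w generalizing m g with
  | nil =>
    simp only [sigSum]
    split_ifs <;> simp
  | cons b w ih =>
    cases b
    · simp only [sigSum, ih]
    · simp only [sigSum, map_sum, ih]

lemma sigSum_add {M : Type} [AddCommMonoid M] (m : ℕ) (w : List Bool)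
    (g h : List Bool → M) : sigSum m w (fun w' => g w' + h w') = sigSum m w g + sigSum m w h := by
  induction w generalizing m g h with
  | nil =>
    simp only [sigSum]
    split_ifs <;> simp
  | cons b w ih =>
    cases b
    · simp only [sigSum, ih]
    · simp only [sigSum, ih, Finset.sum_add_distrib]

lemma sigSum_zero {M : Type} [AddCommMonoid M] (m : ℕ) (w : List Bool) :
    sigSum m w (fun _ => (0 : M)) = 0 := by
  induction w generalizing m with
  | nil => simp [sigSum]
  | cons b w ih =>
    cases b
    · simp only [sigSum, ih]
    · simp only [sigSum, ih, Finset.sum_const_zero]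

lemma sigSum_finsum {M : Type} [AddCommMonoid M] (m : ℕ) (w : List Bool) (s : Finset ℕ)
    (g : ℕ → List Bool → M) : sigSum m w (fun w' => ∑ a ∈ s, g a w') = ∑ a ∈ s, sigSum m w (g a) := by
  classical
  induction s using Finset.induction_on with
  | empty => simp [sigSum_zero]
  | insert a s ha ih => simp only [Finset.sum_insert ha, sigSum_add, ih]

lemma sigSum_tsum (m : ℕ) (w : List Bool) (g : ℕ → List Bool → ℝ≥0∞) :
    sigSum m w (fun w' => ∑' n, g n w') = ∑' n, sigSum m w (g n) := by
  induction w generalizing m g with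
  | nil =>
    simp only [sigSum]
    split_ifs <;> simp
  | cons b w ih =>
    cases b
    · simp only [sigSum, ih]
    · simp only [sigSum, ih]
      rw [Summable.tsum_finsetSum (fun _ _ => ENNReal.summable)]

lemma sigSum_mul (m : ℕ) (w : List Bool) (c : ℝ≥0∞) (g : List Bool → ℝ≥0∞) :
    sigSum m w (fun w' => c * g w') = c * sigSum m w g :=
  (map_sigSum (AddMonoidHom.mulLeft c) m w g).symm

lemma sigSum_congr {M : Type} [AddCommMonoid M] (m : ℕ) (u : List Bool) (g h : List Bool → M)
    (H : ∀ u, g (u ++ [true]) = h (u ++ [true])) :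
    sigSum m (u ++ [true]) g = sigSum m (u ++ [true]) h := by
  induction u generalizing m g h with
  | nil =>
    simp only [List.nil_append, sigSum, H]
  | cons b u ih =>
    cases b
    · simp only [List.cons_append, sigSum]
      exact ih _ _ _ fun u => H (false :: u)
    · simp only [List.cons_append, sigSum]
      refine Finset.sum_congr rfl fun p _ => ih _ _ _ fun u => ?_
      have := H (List.replicate p.2 false ++ true :: u)
      simpa using this

lemma EE_replicate (j : ℕ) (w : List Bool) : EE (List.replicate j false ++ w) = EE w * Hx ^ j := by
  induction j with
  | zero => simp
  | succ j ih =>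
    rw [List.replicate_succ, List.cons_append, EE, ih, mul_assoc, pow_succ]
    rfl

lemma sigSum_EE (m : ℕ) (w : List Bool) : sigSum m w EE = PowerSeries.coeff m (sg (EE w)) := by
  induction w generalizing m with
  | nil => simp [sigSum, EE, PowerSeries.coeff_one]
  | cons b w ih =>
    cases b
    · simp only [sigSum, EE]
      have := map_sigSum (AddMonoidHom.mulRight (FreeAlgebra.ι ℚ false : H)) m w EE
      simp only [AddMonoidHom.coe_mulRight] at this
      rw [← this, ih]
      change _ = PowerSeries.coeff m (sg (EE w * Hx))
      rw [map_mul, sg_x, PowerSeries.coeff_mul_C]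
      rfl
    · simp only [sigSum]
      change _ = PowerSeries.coeff m (sg (EE w * Hy))
      rw [map_mul, sg_y, PowerSeries.coeff_mul]
      refine Finset.sum_congr rfl fun p _ => ?_
      simp only [EE_replicate, EE]
      rw [PowerSeries.coeff_C_mul, geo, PowerSeries.coeff_mk, ← ih]
      have := map_sigSum (AddMonoidHom.mulRight (Hy * Hx ^ p.2 : H)) p.1 w EE
      simp only [AddMonoidHom.coe_mulRight] at this
      rw [this]
      simp only [← mul_assoc]
      rfl

lemma AA_replicate (t : ℝ) (j : ℕ) (w : List Bool) (n : ℕ) :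
    AA t (List.replicate j false ++ w) n = wt 0 n ^ j * AA t w n := by
  induction j with
  | zero => simp
  | succ j ih =>
    rw [List.replicate_succ, List.cons_append, AA, ih, pow_succ']
    ring

lemma cauchy (f g : ℕ → ℝ≥0∞) :
    ∑' m, ∑ p ∈ antidiagonal m, f p.1 * g p.2 = (∑' i, f i) * ∑' j, g j := by
  rw [← ENNReal.tsum_mul_right]
  simp only [← ENNReal.tsum_mul_left]
  rw [← ENNReal.tsum_prod (f := fun i j => f i * g j),
    ← (Finset.HasAntidiagonal.sigmaAntidiagonalEquivProd (A := ℕ)).tsum_eq, ENNReal.tsum_sigma']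
  refine tsum_congr fun m => ?_
  rw [tsum_fintype, ← Finset.sum_coe_sort]
  rfl

lemma wt_geom {t : ℝ} (ht0 : 0 ≤ t) (ht : t < 1) (n : ℕ) :
    ∑' j, ENNReal.ofReal t ^ j * wt 0 n ^ (j + 1) = wt t n := by
  by_cases hn : n = 0
  · simp [wt, hn]
  · have hn1 : (1 : ℝ) ≤ n := by exact_mod_cast Nat.one_le_iff_ne_zero.2 hn
    have hn0 : (0 : ℝ) < n := by linarith
    have hlt : t / n < 1 := by rw [div_lt_one hn0]; linarith
    have hs := (hasSum_geometric_of_lt_one (r := t / n) (by positivity) hlt).mul_right (1 / (n : ℝ))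
    simp only [wt, if_neg hn, sub_zero]
    have : ∀ j : ℕ, ENNReal.ofReal t ^ j * ENNReal.ofReal (1 / (n : ℝ)) ^ (j + 1)
        = ENNReal.ofReal ((t / n) ^ j * (1 / (n : ℝ))) := by
      intro j
      rw [← ENNReal.ofReal_pow ht0, ← ENNReal.ofReal_pow (by positivity),
        ← ENNReal.ofReal_mul (by positivity)]
      congr 1
      rw [pow_succ, div_pow, div_pow, one_pow]
      ring
    simp only [this]
    rw [← ENNReal.ofReal_tsum_of_nonneg (fun j => by positivity) hs.summable, hs.tsum_eq]
    congr 1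
    have : (n : ℝ) - t ≠ 0 := by linarith
    have : 1 - t / n ≠ 0 := by linarith
    field_simp

lemma AA_expand {t : ℝ} (ht0 : 0 ≤ t) (ht : t < 1) (w : List Bool) (n : ℕ) :
    AA t w n = ∑' m, ENNReal.ofReal t ^ m * sigSum m w (fun w' => AA 0 w' n) := by
  induction w generalizing n with
  | nil =>
    rw [tsum_eq_single 0]
    · simp [sigSum, AA]
    · intro m hm
      simp [sigSum, hm]
  | cons b w ih =>
    cases b
    · simp only [AA, sigSum, sigSum_mul, ih n, ← ENNReal.tsum_mul_left]
      refine tsum_congr fun m => ?_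
      ring
    · simp only [AA, sigSum, AA_replicate, sigSum_mul, sigSum_finsum]
      rw [Finset.sum_congr rfl fun a _ => ih a, ← Summable.tsum_finsetSum (fun _ _ => ENNReal.summable),
        ← wt_geom ht0 ht, mul_comm, ← cauchy]
      refine tsum_congr fun m => ?_
      rw [Finset.mul_sum]
      refine Finset.sum_congr rfl fun p hp => ?_
      rw [mem_antidiagonal] at hp
      rw [← hp, ← Finset.mul_sum, pow_add]
      ring

lemma FF_expand {t : ℝ} (ht0 : 0 ≤ t) (ht : t < 1) (w : List Bool) :
    FF t w = ∑' m, ENNReal.ofReal t ^ m * sigSum m w (FF 0) := by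
  rw [FF]
  simp only [AA_expand ht0 ht w]
  rw [ENNReal.tsum_comm]
  refine tsum_congr fun m => ?_
  rw [ENNReal.tsum_mul_left, ← sigSum_tsum]
  rfl

end OhnoAux

namespace OhnoAux

open scoped ENNReal NNReal
open Finset.HasAntidiagonal

/-! ### Link with the definition of multiple zeta values -/

/-- truncated multiple zeta values -/
def GS (r : ℕ) (k : Fin r → ℕ) (N : ℕ) : ℝ≥0∞ :=
  ∑' n : Fin r → ℕ, if (∀ i, 0 < n i) ∧ StrictMono n ∧ (∀ i, n i < N) then
    ∏ i, ENNReal.ofReal (1 / (n i : ℝ) ^ k i) else 0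

lemma strictMono_snoc {r : ℕ} (n : Fin r → ℕ) (a : ℕ) :
    StrictMono (Fin.snoc n a : Fin (r + 1) → ℕ) ↔ StrictMono n ∧ ∀ i, n i < a := by
  constructor
  · intro h
    refine ⟨fun i j hij => ?_, fun i => ?_⟩
    · have := h (Fin.castSucc_lt_castSucc_iff.2 hij)
      simpa using this
    · have := h (Fin.castSucc_lt_last i)
      simpa using this
  · rintro ⟨h1, h2⟩ i j hij
    induction j using Fin.lastCases with
    | last =>
      induction i using Fin.lastCases with
      | last => exact absurd hij (lt_irrefl _)
      | cast i => simpa using h2 i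
    | cast j =>
      induction i using Fin.lastCases with
      | last => exact absurd hij (not_lt.2 (Fin.le_last _))
      | cast i => simpa using h1 (Fin.castSucc_lt_castSucc_iff.1 hij)

lemma GS_step (r : ℕ) (k : Fin r → ℕ) (l : ℕ) (Q : ℕ → Prop) [DecidablePred Q] :
    (∑' n : Fin (r + 1) → ℕ, if (∀ i, 0 < n i) ∧ StrictMono n ∧ Q (n (Fin.last r)) then
      ∏ i, ENNReal.ofReal (1 / (n i : ℝ) ^ (Fin.snoc k l : Fin (r + 1) → ℕ) i) else 0)
    = ∑' a : ℕ, if 0 < a ∧ Q a then ENNReal.ofReal (1 / (a : ℝ) ^ l) * GS r k a else 0 := by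
  rw [← (Fin.snocEquiv (fun _ : Fin (r + 1) => ℕ)).tsum_eq, ENNReal.tsum_prod']
  refine tsum_congr fun a => ?_
  split_ifs with h
  · rw [GS, ← ENNReal.tsum_mul_left]
    refine tsum_congr fun n => ?_
    have e : (Fin.snocEquiv (fun _ : Fin (r + 1) => ℕ)) (a, n) = (Fin.snoc n a : Fin (r + 1) → ℕ) := rfl
    rw [e]
    have hiff : ((∀ i, 0 < (Fin.snoc n a : Fin (r + 1) → ℕ) i) ∧ StrictMono (Fin.snoc n a : Fin (r + 1) → ℕ) ∧
        Q ((Fin.snoc n a : Fin (r + 1) → ℕ) (Fin.last r))) ↔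
        ((∀ i, 0 < n i) ∧ StrictMono n ∧ ∀ i, n i < a) := by
      rw [strictMono_snoc, Fin.forall_fin_succ']
      simp only [Fin.snoc_castSucc, Fin.snoc_last]
      have h1 := h.1
      have h2 := h.2
      tauto
    by_cases h2 : (∀ i, 0 < n i) ∧ StrictMono n ∧ ∀ i, n i < a
    · rw [if_pos h2, if_pos (hiff.2 h2), Fin.prod_univ_castSucc, mul_comm]
      simp only [Fin.snoc_castSucc, Fin.snoc_last]
    · rw [if_neg h2, if_neg (mt hiff.1 h2), mul_zero]
  · rw [ENNReal.tsum_eq_zero]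
    intro n
    have e : (Fin.snocEquiv (fun _ : Fin (r + 1) => ℕ)) (a, n) = (Fin.snoc n a : Fin (r + 1) → ℕ) := rfl
    rw [if_neg]
    rintro ⟨h1, _, h2⟩
    refine h ⟨?_, ?_⟩
    · simpa [e] using h1 (Fin.last r)
    · simpa [e] using h2

lemma GS_succ (r : ℕ) (k : Fin r → ℕ) (l : ℕ) (N : ℕ) :
    GS (r + 1) (Fin.snoc k l) N = ∑ a ∈ Finset.range N,
      (if a = 0 then 0 else ENNReal.ofReal (1 / (a : ℝ) ^ l)) * GS r k a := by
  rw [sum_range_ite]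
  have h := GS_step r k l (fun a => a < N)
  rw [GS]
  refine Eq.trans (tsum_congr fun n => if_congr ?_ rfl rfl) (h.trans (tsum_congr fun a => ?_))
  · refine and_congr_right fun _ => and_congr_right fun hm => ?_
    exact ⟨fun h => h _, fun h i => (hm.monotone (Fin.le_last i)).trans_lt h⟩
  · by_cases h1 : a = 0
    · simp [h1]
    · by_cases h2 : a < N
      · simp [h1, h2, Nat.pos_of_ne_zero h1]
      · simp [h2]

lemma GS_zero (k : Fin 0 → ℕ) (N : ℕ) : GS 0 k N = 1 := by
  rw [GS, tsum_eq_single default]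
  · rw [if_pos]
    · simp
    · exact ⟨fun i => i.elim0, fun i => i.elim0, fun i => i.elim0⟩
  · intro n hn
    exact absurd (Subsingleton.elim _ _) hn

lemma MZV_eq (r : ℕ) (k : Fin r → ℕ) (l : ℕ) :
    MZV (r + 1) (Fin.snoc k l) =
      (∑' a : ℕ, (if a = 0 then 0 else ENNReal.ofReal (1 / (a : ℝ) ^ l)) * GS r k a).toReal := by
  have h := GS_step r k l (fun _ => True)
  have h2 : (∑' a : ℕ, (if a = 0 then 0 else ENNReal.ofReal (1 / (a : ℝ) ^ l)) * GS r k a)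
      = ∑' a : ℕ, if 0 < a ∧ True then ENNReal.ofReal (1 / (a : ℝ) ^ l) * GS r k a else 0 := by
    refine tsum_congr fun a => ?_
    by_cases h1 : a = 0
    · simp [h1]
    · simp [h1, Nat.pos_of_ne_zero h1]
  rw [h2, ← h, MZV]
  have h3 : ∀ n : {n : Fin (r + 1) → ℕ // (∀ i, 0 < n i) ∧ StrictMono n},
      ∏ i, (1 : ℝ) / (n.1 i : ℝ) ^ ((Fin.snoc k l : Fin (r + 1) → ℕ) i)
      = (∏ i, ENNReal.ofReal (1 / (n.1 i : ℝ) ^ (Fin.snoc k l : Fin (r + 1) → ℕ) i)).toReal := by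
    intro n
    rw [ENNReal.toReal_prod]
    refine Finset.prod_congr rfl fun i _ => ?_
    rw [ENNReal.toReal_ofReal (by positivity)]
  rw [tsum_congr h3, ← ENNReal.tsum_toReal_eq (fun n => ENNReal.prod_ne_top fun i _ => ENNReal.ofReal_ne_top)]
  congr 1
  have h4 := tsum_subtype {n : Fin (r + 1) → ℕ | (∀ i, 0 < n i) ∧ StrictMono n}
    (fun n => ∏ i, ENNReal.ofReal (1 / (n i : ℝ) ^ (Fin.snoc k l : Fin (r + 1) → ℕ) i))
  refine h4.trans (tsum_congr fun n => ?_)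
  classical
  rw [Set.indicator_apply]
  refine if_congr ?_ rfl rfl
  simp

lemma word_struct (u : List Bool) : ∃ (r : ℕ) (k : Fin r → ℕ) (l : ℕ), (∀ i, 1 ≤ k i) ∧ 1 ≤ l ∧
    EE (u ++ [true]) = (List.ofFn fun i => Hy * Hx ^ (k i - 1)).prod * (Hy * Hx ^ (l - 1)) ∧
    ∀ n, AA 0 (u ++ [true]) n = (if n = 0 then 0 else ENNReal.ofReal (1 / (n : ℝ) ^ l)) * GS r k n := by
  induction u with
  | nil =>
    refine ⟨0, Fin.elim0, 1, fun i => i.elim0, le_rfl, ?_, fun n => ?_⟩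
    · simp [EE, Hy]
    · rw [GS_zero]
      by_cases hn : n = 0
      · simp [AA, wt, hn]
      · simp [AA, wt, hn, Nat.pos_of_ne_zero hn]
  | cons b u ih =>
    obtain ⟨r, k, l, hk, hl, h1, h2⟩ := ih
    cases b
    · refine ⟨r, k, l + 1, hk, by omega, ?_, fun n => ?_⟩
      · rw [List.cons_append, EE, h1, mul_assoc, mul_assoc]
        congr 2
        change Hx ^ (l - 1) * Hx = _
        rw [← pow_succ]
        congr 1
        omega
      · rw [List.cons_append, AA, h2, ← mul_assoc]
        congr 1
        by_cases hn : n = 0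
        · simp [hn]
        · rw [wt, if_neg hn, if_neg hn, if_neg hn, ← ENNReal.ofReal_mul (by rw [sub_zero]; positivity)]
          congr 1
          rw [sub_zero, pow_succ']
          field_simp
    · refine ⟨r + 1, Fin.snoc k l, 1, ?_, le_rfl, ?_, fun n => ?_⟩
      · intro i
        induction i using Fin.lastCases with
        | last => simpa using hl
        | cast i => simpa using hk i
      · rw [List.cons_append, EE, h1, List.ofFn_succ']
        simp [Hy]
      · rw [List.cons_append, AA, GS_succ]
        congr 1
        · simp [wt]
        · exact Finset.sum_congr rfl fun a _ => h2 a

lemma Z_word (Z : H →ₗ[ℚ] ℝ) (hZ : IsZetaMap Z) (u : List Bool) :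
    Z (EE (false :: (u ++ [true]))) = (FF 0 (false :: (u ++ [true]))).toReal := by
  obtain ⟨r, k, l, hk, hl, h1, h2⟩ := word_struct u
  have h := hZ r (Fin.snoc k (l + 1)) (by
    intro i
    induction i using Fin.lastCases with
    | last => simp
    | cast i => simpa using hk i) (by simp; omega)
  rw [MZV_eq] at h
  have e : EE (false :: (u ++ [true])) =
      (List.ofFn fun i => Hy * Hx ^ ((Fin.snoc k (l + 1) : Fin (r + 1) → ℕ) i - 1)).prod := by
    rw [EE, h1, List.ofFn_succ']
    simp only [Fin.snoc_castSucc, Fin.snoc_last, List.concat_eq_append, List.prod_append, List.prod_singleton]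
    rw [mul_assoc, mul_assoc]
    congr 2
    change Hx ^ (l - 1) * Hx = _
    rw [← pow_succ]
    congr 1
    omega
  rw [e, h, FF]
  congr 1
  refine tsum_congr fun n => ?_
  rw [AA, h2, ← mul_assoc]
  congr 1
  by_cases hn : n = 0
  · simp [hn]
  · rw [wt, if_neg hn, if_neg hn, if_neg hn, ← ENNReal.ofReal_mul (by rw [sub_zero]; positivity)]
    congr 1
    rw [sub_zero, pow_succ']
    field_simp

/-! ### Uniqueness of power series coefficients -/

lemma ps_zero (c : ℕ → ℝ) (hs : Summable fun n => |c n| * (1 / 2) ^ n)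
    (h : ∀ t : ℝ, 0 < t → t ≤ 1 / 2 → ∑' n, c n * t ^ n = 0) : c 0 = 0 := by
  by_contra hc
  have hc' : 0 < |c 0| := abs_pos.2 hc
  have hs1 := (summable_nat_add_iff 1).2 hs
  set M := ∑' n, |c (n + 1)| * (1 / 2 : ℝ) ^ (n + 1) with hM
  have hM0 : 0 ≤ M := tsum_nonneg fun n => by positivity
  have key : ∀ t : ℝ, 0 < t → t ≤ 1 / 2 → |c 0| ≤ 2 * t * M := by
    intro t ht ht2
    have hb : ∀ n, ‖c (n + 1) * t ^ (n + 1)‖ ≤ 2 * t * (|c (n + 1)| * (1 / 2 : ℝ) ^ (n + 1)) := by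
      intro n
      rw [norm_mul, Real.norm_eq_abs, Real.norm_eq_abs, abs_of_pos (pow_pos ht _), pow_succ, pow_succ]
      have : t ^ n ≤ (1 / 2 : ℝ) ^ n := pow_le_pow_left₀ ht.le ht2 n
      have h3 : |c (n + 1)| * t * t ^ n ≤ |c (n + 1)| * t * (1 / 2 : ℝ) ^ n := by gcongr
      linarith
    have hs2 : Summable fun n => c (n + 1) * t ^ (n + 1) :=
      Summable.of_norm_bounded (hs1.mul_left (2 * t)) hb
    have hs3 : Summable fun n => c n * t ^ n := (summable_nat_add_iff 1).1 hs2
    have h4 := hs3.tsum_eq_zero_add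
    rw [h t ht ht2, pow_zero, mul_one] at h4
    have h5 : c 0 = - ∑' n, c (n + 1) * t ^ (n + 1) := by linarith
    rw [h5, abs_neg, hM, ← tsum_mul_left]
    exact tsum_of_norm_bounded (hs1.mul_left (2 * t)).hasSum hb
  have h6 := key (min (1 / 2) (|c 0| / (4 * (M + 1)))) (by positivity) (min_le_left _ _)
  have h7 : min (1 / 2) (|c 0| / (4 * (M + 1))) ≤ |c 0| / (4 * (M + 1)) := min_le_right _ _
  have h8 : 2 * min (1 / 2) (|c 0| / (4 * (M + 1))) * M ≤ 2 * (|c 0| / (4 * (M + 1))) * M := by gcongr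
  have h9 : 2 * (|c 0| / (4 * (M + 1))) * M < |c 0| := by
    rw [show 2 * (|c 0| / (4 * (M + 1))) * M = (2 * |c 0| * M) / (4 * (M + 1)) by ring,
      div_lt_iff₀ (by positivity)]
    nlinarith
  linarith

lemma ps_zero_all (m : ℕ) : ∀ (c : ℕ → ℝ), (Summable fun n => |c n| * (1 / 2) ^ n) →
    (∀ t : ℝ, 0 < t → t ≤ 1 / 2 → ∑' n, c n * t ^ n = 0) → c m = 0 := by
  induction m with
  | zero => exact ps_zero
  | succ m ih =>
    intro c hs h
    have h0 := ps_zero c hs h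
    have hs1 := (summable_nat_add_iff 1).2 hs
    refine ih (fun n => c (n + 1)) ?_ ?_
    · refine (hs1.mul_left 2).congr fun n => ?_
      rw [pow_succ]; ring
    · intro t ht ht2
      have h1 := h t ht ht2
      have hs3 : Summable fun n => c n * t ^ n := by
        refine Summable.of_norm_bounded hs fun n => ?_
        rw [norm_mul, Real.norm_eq_abs, Real.norm_eq_abs, abs_of_pos (pow_pos ht _)]
        have : t ^ n ≤ (1 / 2 : ℝ) ^ n := pow_le_pow_left₀ ht.le ht2 n
        gcongr
      rw [hs3.tsum_eq_zero_add, h0, zero_mul, zero_add] at h1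
      have : (fun n => c (n + 1) * t ^ (n + 1)) = fun n => (c (n + 1) * t ^ n) * t := by
        ext n; rw [pow_succ]; ring
      rw [this, tsum_mul_right] at h1
      exact (mul_eq_zero.1 h1).resolve_right ht.ne'

lemma ps_eq (a b : ℕ → ℝ≥0)
    (h : ∀ t : ℝ, 0 ≤ t → t ≤ 1 / 2 →
      ∑' m, ENNReal.ofReal t ^ m * (a m : ℝ≥0∞) = ∑' m, ENNReal.ofReal t ^ m * (b m : ℝ≥0∞))
    (hfin : ∀ t : ℝ, 0 ≤ t → t ≤ 1 / 2 → ∑' m, ENNReal.ofReal t ^ m * (a m : ℝ≥0∞) ≠ ∞) (m : ℕ) : a m = b m := by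
  have aux : ∀ (a : ℕ → ℝ≥0) (t : ℝ), 0 ≤ t → ∑' m, ENNReal.ofReal t ^ m * (a m : ℝ≥0∞) ≠ ∞ →
      HasSum (fun m => (a m : ℝ) * t ^ m) (∑' m, ENNReal.ofReal t ^ m * (a m : ℝ≥0∞)).toReal := by
    intro a t ht hf
    have h1 := ENNReal.hasSum_toReal hf
    rw [← ENNReal.tsum_toReal_eq (fun m => ENNReal.mul_ne_top (ENNReal.pow_ne_top ENNReal.ofReal_ne_top) ENNReal.coe_ne_top)] at h1
    refine (congrArg (fun f => HasSum f _) ?_).mp h1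
    ext m
    rw [ENNReal.toReal_mul, ENNReal.toReal_pow, ENNReal.toReal_ofReal ht, mul_comm]
    rfl
  have hsub : (a m : ℝ) - b m = 0 := by
    refine ps_zero_all m (fun m => (a m : ℝ) - b m) ?_ ?_
    · have h1 := (aux a (1 / 2) (by norm_num) (hfin _ (by norm_num) le_rfl)).summable
      have h2 := (aux b (1 / 2) (by norm_num) (h _ (by norm_num) le_rfl ▸ hfin _ (by norm_num) le_rfl)).summable
      have h3 := (h1.sub h2).abs
      refine h3.congr fun n => ?_
      rw [← sub_mul, abs_mul, abs_of_pos (pow_pos (by norm_num : (0 : ℝ) < 1 / 2) n)]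
    · intro t ht ht2
      have h1 := aux a t ht.le (hfin _ ht.le ht2)
      have h2 := aux b t ht.le (h _ ht.le ht2 ▸ hfin _ ht.le ht2)
      rw [← h _ ht.le ht2] at h2
      have h3 := h1.sub h2
      simp only [← sub_mul, sub_self] at h3
      exact h3.tsum_eq
  exact NNReal.coe_injective (sub_eq_zero.1 hsub)

/-! ### Ohno's relation -/

def alpha (m : ℕ) (u : List Bool) : ℝ≥0 :=
  sigSum m u fun w' => (FF 0 (false :: w')).toNNReal

lemma alpha_coe (m : ℕ) (u : List Bool) : (alpha m u : ℝ≥0∞) = sigSum m (false :: u) (FF 0) := by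
  have := map_sigSum (ENNReal.ofNNRealHom : ℝ≥0 →+* ℝ≥0∞).toAddMonoidHom m u
    (fun w' => (FF 0 (false :: w')).toNNReal)
  rw [sigSum]
  refine this.trans ?_
  congr 1
  ext1 w'
  exact ENNReal.coe_toNNReal (FF_lt_top (by norm_num) w')

lemma alpha_dual (m : ℕ) (u : List Bool) :
    alpha m (u ++ [true]) = alpha m ((u.map not).reverse ++ [true]) := by
  revert m
  refine fun m => ps_eq (fun m => alpha m (u ++ [true])) (fun m => alpha m ((u.map not).reverse ++ [true])) ?_ ?_ m
  · intro t ht ht2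
    simp only [alpha_coe]
    rw [← FF_expand ht (by linarith), ← FF_expand ht (by linarith)]
    exact FF_dual ht (by linarith) u
  · intro t ht ht2
    simp only [alpha_coe]
    rw [← FF_expand ht (by linarith)]
    exact FF_lt_top ht2 _

lemma Z_sg_word (Z : H →ₗ[ℚ] ℝ) (hZ : IsZetaMap Z) (m : ℕ) (u : List Bool) :
    Z (PowerSeries.coeff m (sg (EE (false :: (u ++ [true]))))) = alpha m (u ++ [true]) := by
  rw [← sigSum_EE]
  have h1 := map_sigSum Z.toAddMonoidHom m (false :: (u ++ [true])) EE
  refine h1.trans ?_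
  rw [sigSum, alpha]
  have h2 := map_sigSum (NNReal.toRealHom : ℝ≥0 →+* ℝ).toAddMonoidHom m (u ++ [true])
    (fun w' => (FF 0 (false :: w')).toNNReal)
  refine Eq.trans ?_ h2.symm
  refine sigSum_congr _ _ _ _ fun u => ?_
  exact Z_word Z hZ u

/-! ### The anti-automorphism -/

def tauHom : H →ₐ[ℚ] Hᵐᵒᵖ := FreeAlgebra.lift ℚ fun b => MulOpposite.op (FreeAlgebra.ι ℚ (!b))

def tau : H →ₗ[ℚ] H where
  toFun v := (tauHom v).unop
  map_add' a b := by simp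
  map_smul' a b := by simp

lemma tau_mul (a b : H) : tau (a * b) = tau b * tau a := by simp [tau]
lemma tau_one : tau 1 = 1 := by simp [tau]
lemma tau_gen (b : Bool) : tau (FreeAlgebra.ι ℚ b) = FreeAlgebra.ι ℚ (!b) := by simp [tau, tauHom]
lemma tau_x : tau Hx = Hy := tau_gen false
lemma tau_y : tau Hy = Hx := tau_gen true

lemma tau_pow (a : H) (j : ℕ) : tau (a ^ j) = tau a ^ j := by
  induction j with
  | zero => simp [tau_one]
  | succ j ih => rw [pow_succ, tau_mul, ih, pow_succ']

lemma coeff_bsg (v : H) : ∀ m, PowerSeries.coeff m (bsg v) = tau (PowerSeries.coeff m (sg (tau v))) := by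
  refine FreeAlgebra.induction ℚ Bool
    (motive := fun v => ∀ m, PowerSeries.coeff m (bsg v) = tau (PowerSeries.coeff m (sg (tau v)))) ?_ ?_ ?_ ?_ v
  · intro r m
    rw [Algebra.algebraMap_eq_smul_one, map_smul bsg, map_smul tau, map_smul sg, tau_one, map_one bsg, map_one sg]
    simp only [PowerSeries.coeff_smul, map_smul, PowerSeries.coeff_one]
    split_ifs <;> simp [tau_one]
  · intro b m
    cases b
    · change PowerSeries.coeff m (bsg Hx) = tau (PowerSeries.coeff m (sg (tau Hx)))
      rw [tau_x, sg_y, bsg_x, PowerSeries.coeff_C_mul, PowerSeries.coeff_mul_C, tau_mul, tau_y]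
      simp [geo, tau_pow, tau_x]
    · change PowerSeries.coeff m (bsg Hy) = tau (PowerSeries.coeff m (sg (tau Hy)))
      rw [tau_y, sg_x, bsg_y, PowerSeries.coeff_C, PowerSeries.coeff_C]
      split_ifs <;> simp [tau_x]
  · intro a b ha hb m
    rw [tau_mul, map_mul bsg, map_mul sg, PowerSeries.coeff_mul, PowerSeries.coeff_mul, map_sum,
      ← Finset.Nat.sum_antidiagonal_swap]
    refine Finset.sum_congr rfl fun p _ => ?_
    rw [tau_mul, ha, hb]
    rfl
  · intro a b ha hb m
    simp only [map_add, ha, hb]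

lemma EE_append (a b : List Bool) : EE (a ++ b) = EE b * EE a := by
  induction a with
  | nil => simp [EE]
  | cons c a ih => rw [List.cons_append, EE, ih, EE, mul_assoc]

lemma tau_EE (w : List Bool) : tau (EE w) = EE ((w.map not).reverse) := by
  induction w with
  | nil => simp [EE, tau_one]
  | cons b w ih =>
    rw [EE, tau_mul, ih, tau_gen, List.map_cons, List.reverse_cons, EE_append]
    simp [EE]

lemma mem_span_EE (v : H) : v ∈ Submodule.span ℚ (Set.range EE) := by
  suffices h : ∀ u ∈ Submodule.span ℚ (Set.range EE), u * v ∈ Submodule.span ℚ (Set.range EE) by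
    have := h 1 (Submodule.subset_span ⟨[], rfl⟩)
    rwa [one_mul] at this
  refine FreeAlgebra.induction ℚ Bool
    (motive := fun v => ∀ u ∈ Submodule.span ℚ (Set.range EE), u * v ∈ Submodule.span ℚ (Set.range EE))
    ?_ ?_ ?_ ?_ v
  · intro r u hu
    rw [Algebra.algebraMap_eq_smul_one, mul_smul_comm, mul_one]
    exact Submodule.smul_mem _ _ hu
  · intro b u hu
    induction hu using Submodule.span_induction with
    | mem x hx =>
      obtain ⟨w, rfl⟩ := hx
      exact Submodule.subset_span ⟨b :: w, rfl⟩
    | zero => simp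
    | add x y _ _ hx hy => rw [add_mul]; exact Submodule.add_mem _ hx hy
    | smul a x _ hx => rw [smul_mul_assoc]; exact Submodule.smul_mem _ _ hx
  · intro a b ha hb u hu
    rw [← mul_assoc]
    exact hb _ (ha _ hu)
  · intro a b ha hb u hu
    rw [mul_add]
    exact Submodule.add_mem _ (ha _ hu) (hb _ hu)

lemma EE_adm (w : List Bool) : EE (false :: (w ++ [true])) = Hy * EE w * Hx := by
  rw [EE, EE_append]
  simp [EE, Hx, Hy]

/-- to check an additive statement on `yHx`, check it on words -/
lemma adm_induction (p : H → Prop) (hadd : ∀ a b, p a → p b → p (a + b)) (hzero : p 0)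
    (hsmul : ∀ (r : ℚ) a, p a → p (r • a)) (hw : ∀ u, p (EE (false :: (u ++ [true]))))
    (v : H) (hv : Adm v) : p v := by
  obtain ⟨u, rfl⟩ := hv
  have hu := mem_span_EE u
  induction hu using Submodule.span_induction with
  | mem x hx =>
    obtain ⟨w, rfl⟩ := hx
    rw [← EE_adm]
    exact hw w
  | zero => simpa using hzero
  | add x y _ _ hx hy => rw [mul_add, add_mul]; exact hadd _ _ hx hy
  | smul a x _ hx => rw [mul_smul_comm, smul_mul_assoc]; exact hsmul _ _ hx

lemma tau_word (u : List Bool) : tau (EE (false :: (u ++ [true]))) =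
    EE (false :: ((u.map not).reverse ++ [true])) := by
  rw [tau_EE]
  simp

lemma Z_tau (Z : H →ₗ[ℚ] ℝ) (hZ : IsZetaMap Z) (v : H) (hv : Adm v) : Z (tau v) = Z v := by
  refine adm_induction (fun v => Z (tau v) = Z v) ?_ ?_ ?_ ?_ v hv
  · intro a b ha hb
    simp only [map_add, ha, hb]
  · simp
  · intro r a ha
    simp only [map_smul, ha]
  · intro u
    have h1 := Z_sg_word Z hZ 0 u
    have h2 := Z_sg_word Z hZ 0 ((u.map not).reverse)
    rw [coeff_zero_sg] at h1 h2
    rw [tau_word, h1, h2, ← alpha_dual]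

theorem ohno (Z : H →ₗ[ℚ] ℝ) (hZ : IsZetaMap Z) (m : ℕ) (v : H) (hv : Adm v) :
    Z (PowerSeries.coeff m (sg v)) = Z (PowerSeries.coeff m (bsg v)) := by
  refine adm_induction (fun v => Z (PowerSeries.coeff m (sg v)) = Z (PowerSeries.coeff m (bsg v)))
    ?_ ?_ ?_ ?_ v hv
  · intro a b ha hb
    simp only [map_add, ha, hb]
  · simp
  · intro r a ha
    simp only [map_smul, PowerSeries.coeff_smul, ha]
  · intro u
    rw [coeff_bsg, Z_tau Z hZ, tau_word, Z_sg_word Z hZ, Z_sg_word Z hZ, alpha_dual]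
    apply adm_sg
    rw [tau_word, EE_adm]
    exact ⟨_, rfl⟩

end OhnoAux


/-- Derivation relation. Let `l ≥ 1` and let `∂_l` be the
derivation on `ℌ` with `∂_l(x) = y(x+y)^{l-1}x` and `∂_l(y) = -y(x+y)^{l-1}x`.
For every `A ∈ yℌ`, `B ∈ ℌx` and every `s ≥ 0`,
`Z(∂_l(A)(x+y)^s B) + Z(A(x+y)^s ∂_l(B)) = 0`;
equivalently `f(∂_l(A), B) + f(A, ∂_l(B)) = 0`. -/
theorem statement16 (Z : H →ₗ[ℚ] ℝ) (hZ : IsZetaMap Z)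
    (l : ℕ) (hl : 1 ≤ l) (D : H →ₗ[ℚ] H)
    (hD : ∀ a b : H, D (a * b) = D a * b + a * D b)
    (hDx : D Hx = Hy * (Hx + Hy) ^ (l - 1) * Hx)
    (hDy : D Hy = -(Hy * (Hx + Hy) ^ (l - 1) * Hx))
    (A B : H) (hA : ∃ w, A = Hy * w) (hB : ∃ w, B = w * Hx) (s : ℕ) :
    Z (D A * (Hx + Hy) ^ s * B) + Z (A * (Hx + Hy) ^ s * D B) = 0 := by
  exact OhnoAux.main_of_ohno Z (OhnoAux.ohno Z hZ) l hl D hD hDx hDy A B hA hB s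

end
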